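/- arXiv:2112.09486 — 3 statements merged into one kernel-verified Lean document; each statement's English description precedes it below -/
import Mathlib

section
/- For every f ∈ A(D) with Taylor coefficients (a_k), every t > 0 and every z with |z| ≤ 1, the complex Gauss–Weierstrass singular integral admits the series representation (1/√(2πt)) ∫_ℝ f(z e^{-iu}) e^{-u²/(2t)} du = ∑_{k=0}^∞ a_k z^k e^{-k² t/2}, where the series converges absolutely (note |a_k| ≤ sup_{|z|≤1}|f(z)| by Cauchy's estimates). -/
open MeasureTheory Complex Real

/-- Cauchy's estimate for functions in the disk algebra. -/
theorem norm_taylorCoeff_le_of_forall_norm_le {f : ℂ → ℂ} {a : ℕ → ℂ} {M : ℝ}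
    (hf_an : DifferentiableOn ℂ f (Metric.ball (0 : ℂ) 1))
    (hf_cont : ContinuousOn f (Metric.closedBall (0 : ℂ) 1))
    (hf_taylor : ∀ z ∈ Metric.ball (0 : ℂ) 1, HasSum (fun k : ℕ => a k * z ^ k) (f z))
    (hM : ∀ z ∈ Metric.closedBall (0 : ℂ) 1, ‖f z‖ ≤ M) (k : ℕ) : ‖a k‖ ≤ M := by
  have hd : DiffContOnCl ℂ f (Metric.ball 0 1) :=
    ⟨hf_an, by rwa [closure_ball (0 : ℂ) one_ne_zero]⟩
  have h1 := norm_iteratedDeriv_le_of_forall_mem_sphere_norm_le k one_pos hd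
    fun z hz => hM z (Metric.sphere_subset_closedBall hz)
  have hp : HasFPowerSeriesAt f (FormalMultilinearSeries.ofScalars ℂ a) 0 := by
    rw [hasFPowerSeriesAt_iff]
    filter_upwards [Metric.ball_mem_nhds (0 : ℂ) one_pos] with z hz
    simpa [mul_comm] using hf_taylor z hz
  have h2 : iteratedDeriv k f 0 = k.factorial * a k := by
    have h := hp.eq_formalMultilinearSeries
      (AnalyticAt.hasFPowerSeriesAt hp.analyticAt)
    have h' := congrArg (fun p => FormalMultilinearSeries.coeff p k) h
    simp only [FormalMultilinearSeries.coeff_ofScalars] at h'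
    rw [h', mul_div_cancel₀ _ (Nat.cast_ne_zero.mpr k.factorial_ne_zero)]
  rw [h2, norm_mul, one_pow, div_one, Complex.norm_natCast] at h1
  exact le_of_mul_le_mul_left h1 (by positivity)

theorem integral_cexp_neg_nat_mul_gaussian {t : ℝ} (ht : 0 < t) (k : ℕ) :
    ∫ u : ℝ, Complex.exp (-Complex.I * (u : ℂ)) ^ k * (Real.exp (-u ^ 2 / (2 * t)) : ℂ) =
      (Real.sqrt (2 * Real.pi * t) : ℂ) * (Real.exp (-(k : ℝ) ^ 2 * t / 2) : ℂ) := by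
  have hb : 0 < ((1 / (2 * t) : ℝ) : ℂ).re := by rw [ofReal_re]; positivity
  have h := fourierIntegral_gaussian hb (-(k : ℂ))
  have ht' : (t : ℂ) ≠ 0 := by exact_mod_cast ht.ne'
  convert h using 1
  · congr 1
    ext u
    rw [← Complex.exp_nat_mul]
    push_cast
    congr 2
    · ring
    · field_simp
  · congr 1
    · rw [Real.sqrt_eq_rpow, Complex.ofReal_cpow (by positivity)]
      push_cast
      congr 1
      field_simp
    · push_cast
      congr 1
      field_simp
      ring

theorem integrable_exp_neg_sq_div {t : ℝ} (ht : 0 < t) :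
    Integrable fun u : ℝ => Real.exp (-u ^ 2 / (2 * t)) := by
  convert integrable_exp_neg_mul_sq (b := 1 / (2 * t)) (by positivity) using 3
  ring

theorem norm_exp_neg_I_mul_ofReal (u : ℝ) : ‖Complex.exp (-Complex.I * (u : ℂ))‖ = 1 := by
  have := Complex.norm_exp_ofReal_mul_I (-u)
  rwa [show ((-u : ℝ) : ℂ) * Complex.I = -Complex.I * u by push_cast; ring] at this

theorem summable_exp_neg_sq_mul {t : ℝ} (ht : 0 < t) :
    Summable fun k : ℕ => Real.exp (-(k : ℝ) ^ 2 * t / 2) := by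
  refine Summable.of_nonneg_of_le (fun _ => (Real.exp_pos _).le) (fun k => ?_)
    (Real.summable_exp_nat_mul_iff.mpr (show -(t / 2) < 0 by linarith))
  apply Real.exp_le_exp.mpr
  have hk : (k : ℝ) ≤ (k : ℝ) ^ 2 := by exact_mod_cast Nat.le_self_pow two_ne_zero k
  nlinarith

theorem hasSum_gauss_weierstrass_of_norm_lt_one {f : ℂ → ℂ} {a : ℕ → ℂ} {M : ℝ}
    (hf_taylor : ∀ z ∈ Metric.ball (0 : ℂ) 1, HasSum (fun k : ℕ => a k * z ^ k) (f z))
    (ha : ∀ k, ‖a k‖ ≤ M) {t : ℝ} (ht : 0 < t) {z : ℂ} (hz : ‖z‖ < 1) :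
    HasSum (fun k : ℕ => a k * z ^ k * (Real.exp (-(k : ℝ) ^ 2 * t / 2) : ℂ))
      (((1 / Real.sqrt (2 * Real.pi * t) : ℝ) : ℂ) *
        ∫ u : ℝ, f (z * Complex.exp (-Complex.I * (u : ℂ))) *
          (Real.exp (-u ^ 2 / (2 * t)) : ℂ)) := by
  have h := hasSum_integral_of_dominated_convergence (μ := volume)
    (F := fun (k : ℕ) (u : ℝ) => a k * z ^ k *
      (Complex.exp (-Complex.I * (u : ℂ)) ^ k * (Real.exp (-u ^ 2 / (2 * t)) : ℂ)))
    (f := fun u : ℝ => f (z * Complex.exp (-Complex.I * (u : ℂ))) *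
      (Real.exp (-u ^ 2 / (2 * t)) : ℂ))
    (fun k u => M * ‖z‖ ^ k * Real.exp (-u ^ 2 / (2 * t)))
    (fun k => Continuous.aestronglyMeasurable (by fun_prop))
    (fun k => .of_forall fun u => ?_) (.of_forall fun u => ?_) ?_ (.of_forall fun u => ?_)
  · have hs : Real.sqrt (2 * Real.pi * t) ≠ 0 := by positivity
    refine (h.mul_left ((1 / Real.sqrt (2 * Real.pi * t) : ℝ) : ℂ)).congr_fun fun k => ?_
    rw [integral_const_mul, integral_cexp_neg_nat_mul_gaussian ht]
    have hs' : (Real.sqrt (2 * Real.pi * t) : ℂ) ≠ 0 := by exact_mod_cast hs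
    push_cast
    field_simp
  · simp only [norm_mul, norm_pow, norm_exp_neg_I_mul_ofReal, one_pow, one_mul]
    rw [Complex.norm_real, Real.norm_of_nonneg (Real.exp_pos _).le]
    gcongr
    exact ha k
  · exact ((summable_geometric_of_lt_one (norm_nonneg z) hz).mul_left M).mul_right _
  · simp only [tsum_mul_right]
    exact (integrable_exp_neg_sq_div ht).const_mul _
  · have hw : z * Complex.exp (-Complex.I * (u : ℂ)) ∈ Metric.ball (0 : ℂ) 1 := by
      rwa [mem_ball_zero_iff, norm_mul, norm_exp_neg_I_mul_ofReal, mul_one]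
    refine ((hf_taylor _ hw).mul_right (Real.exp (-u ^ 2 / (2 * t)) : ℂ)).congr_fun fun k => ?_
    ring

/-- For `f ∈ A(D)` with Taylor coefficients `a`, every `t > 0` and `‖z‖ ≤ 1`,
the complex Gauss–Weierstrass singular integral equals `∑ₖ aₖ zᵏ e^{-k²t/2}`,
the series converging absolutely. -/
theorem gauss_weierstrass_series_representation
    (f : ℂ → ℂ) (a : ℕ → ℂ)
    (hf_an : DifferentiableOn ℂ f (Metric.ball (0 : ℂ) 1))
    (hf_cont : ContinuousOn f (Metric.closedBall (0 : ℂ) 1))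
    (hf_taylor : ∀ z ∈ Metric.ball (0 : ℂ) 1, HasSum (fun k : ℕ => a k * z ^ k) (f z))
    (t : ℝ) (ht : 0 < t) (z : ℂ) (hz : ‖z‖ ≤ 1) :
    Summable (fun k : ℕ => ‖a k * z ^ k * (Real.exp (-(k : ℝ) ^ 2 * t / 2) : ℂ)‖) ∧
    HasSum (fun k : ℕ => a k * z ^ k * (Real.exp (-(k : ℝ) ^ 2 * t / 2) : ℂ))
      (((1 / Real.sqrt (2 * Real.pi * t) : ℝ) : ℂ) *
        ∫ u : ℝ, f (z * Complex.exp (-Complex.I * (u : ℂ))) *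
          (Real.exp (-u ^ 2 / (2 * t)) : ℂ)) := by
  obtain ⟨M, hM⟩ := (isCompact_closedBall (0 : ℂ) 1).exists_bound_of_continuousOn hf_cont
  have ha := norm_taylorCoeff_le_of_forall_norm_le hf_an hf_cont hf_taylor hM
  have hM0 : 0 ≤ M := (norm_nonneg _).trans (ha 0)
  have hbs := (summable_exp_neg_sq_mul ht).mul_left M
  have hterm : ∀ w : ℂ, ‖w‖ ≤ 1 → ∀ k : ℕ,
      ‖a k * w ^ k * (Real.exp (-(k : ℝ) ^ 2 * t / 2) : ℂ)‖ ≤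
        M * Real.exp (-(k : ℝ) ^ 2 * t / 2) := by
    intro w hw k
    rw [norm_mul, norm_mul, norm_pow, Complex.norm_real, Real.norm_of_nonneg (Real.exp_pos _).le]
    gcongr
    exact (mul_le_of_le_one_right (norm_nonneg _) (pow_le_one₀ (norm_nonneg _) hw)).trans (ha k)
  have hsum : Summable (fun k : ℕ => ‖a k * z ^ k * (Real.exp (-(k : ℝ) ^ 2 * t / 2) : ℂ)‖) :=
    Summable.of_nonneg_of_le (fun _ => norm_nonneg _) (hterm z hz) hbs
  refine ⟨hsum, ?_⟩
  have hr : ∀ᶠ r : ℝ in nhdsWithin 1 (Set.Iio 1), 0 < r ∧ r < 1 :=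
    Ioo_mem_nhdsLT one_pos
  have hnorm : ∀ r : ℝ, 0 < r ∧ r < 1 → ‖(r : ℂ) * z‖ < 1 := by
    rintro r ⟨hr0, hr1⟩
    rw [norm_mul, Complex.norm_real, Real.norm_of_nonneg hr0.le]
    nlinarith [norm_nonneg z]
  have hmem : ∀ (w : ℂ) (u : ℝ), ‖w‖ ≤ 1 →
      w * Complex.exp (-Complex.I * (u : ℂ)) ∈ Metric.closedBall (0 : ℂ) 1 := by
    intro w u hw
    rwa [mem_closedBall_zero_iff, norm_mul, norm_exp_neg_I_mul_ofReal, mul_one]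
  have hlim : ∀ g : ℝ → ℂ, Continuous g →
      Filter.Tendsto g (nhdsWithin 1 (Set.Iio 1)) (nhds (g 1)) :=
    fun g hg => hg.continuousAt.tendsto.mono_left nhdsWithin_le_nhds
  have hL : Filter.Tendsto (fun r : ℝ =>
      ∑' k : ℕ, a k * ((r : ℂ) * z) ^ k * (Real.exp (-(k : ℝ) ^ 2 * t / 2) : ℂ))
      (nhdsWithin 1 (Set.Iio 1))
      (nhds (∑' k : ℕ, a k * z ^ k * (Real.exp (-(k : ℝ) ^ 2 * t / 2) : ℂ))) := by
    refine tendsto_tsum_of_dominated_convergence hbs (fun k => ?_) ?_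
    · simpa only [ofReal_one, one_mul] using hlim
        (fun r : ℝ => a k * ((r : ℂ) * z) ^ k * (Real.exp (-(k : ℝ) ^ 2 * t / 2) : ℂ))
        (by fun_prop)
    · filter_upwards [hr] with r h
      exact hterm _ (hnorm r h).le
  have hR : Filter.Tendsto (fun r : ℝ =>
      ∫ u : ℝ, f ((r : ℂ) * z * Complex.exp (-Complex.I * (u : ℂ))) *
        (Real.exp (-u ^ 2 / (2 * t)) : ℂ))
      (nhdsWithin 1 (Set.Iio 1))
      (nhds (∫ u : ℝ, f (z * Complex.exp (-Complex.I * (u : ℂ))) *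
        (Real.exp (-u ^ 2 / (2 * t)) : ℂ))) := by
    refine tendsto_integral_filter_of_dominated_convergence
      (fun u => M * Real.exp (-u ^ 2 / (2 * t))) ?_ ?_
      ((integrable_exp_neg_sq_div ht).const_mul M) (.of_forall fun u => ?_)
    · filter_upwards [hr] with r h
      refine Continuous.aestronglyMeasurable (Continuous.mul ?_ (by fun_prop))
      exact hf_cont.comp_continuous (by fun_prop) fun u => hmem _ u (hnorm r h).le
    · filter_upwards [hr] with r h
      refine .of_forall fun u => ?_
      rw [norm_mul, Complex.norm_real, Real.norm_of_nonneg (Real.exp_pos _).le]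
      gcongr
      exact hM _ (hmem _ u (hnorm r h).le)
    · refine Filter.Tendsto.mul_const _ ?_
      refine (hf_cont _ (hmem z u hz)).tendsto.comp
        (tendsto_nhdsWithin_iff.mpr ⟨?_, ?_⟩)
      · simpa using hlim
          (fun r : ℝ => (r : ℂ) * z * Complex.exp (-Complex.I * (u : ℂ))) (by fun_prop)
      · filter_upwards [hr] with r h
        exact hmem _ u (hnorm r h).le
  rw [← tendsto_nhds_unique_of_eventuallyEq hL (hR.const_mul _) ?_]
  · exact hsum.of_norm.hasSum
  · filter_upwards [hr] with r h
    exact (hasSum_gauss_weierstrass_of_norm_lt_one hf_taylor ha ht (hnorm r h)).tsum_eq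
end

section
/- Let α ∈ (0, 1), λ > 0, and u(t) := E_α(−λ t^α) where E_α(x) = ∑_{j=0}^∞ x^j / Γ(αj + 1). Then u is an eigenfunction of the regularized Caputo derivative with eigenvalue −λ: for every t > 0, the function t ↦ ∫_0^t (t−s)^{-α} (u(s) − 1) ds is differentiable at t and (1/Γ(1−α)) (d/dt) ∫_0^t (t−s)^{-α} (u(s) − u(0)) ds = −λ E_α(−λ t^α), where u(0) = 1. -/
open MeasureTheory Real intervalIntegral

/-- The Mittag-Leffler function `E_α(x) = ∑_{j≥0} x^j / Γ(αj + 1)`. -/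
noncomputable def mittagLeffler (α x : ℝ) : ℝ :=
  ∑' j : ℕ, x ^ j / Real.Gamma (α * j + 1)

theorem rpow_mul_exp_neg_le_Gamma_add_one {M x : ℝ} (hM : 0 < M) (hx : 0 ≤ x) :
    M ^ x * exp (-M) ≤ Gamma (x + 1) := by
  have hI : IntegrableOn (fun y : ℝ ↦ exp (-y) * y ^ (x + 1 - 1)) (Set.Ioi 0) :=
    GammaIntegral_convergent (by linarith)
  have hsub : Set.Ioi M ⊆ Set.Ioi (0 : ℝ) := Set.Ioi_subset_Ioi hM.le
  rw [Gamma_eq_integral (by linarith)]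
  calc M ^ x * exp (-M) = ∫ y in Set.Ioi M, M ^ x * exp (-y) := by
        rw [MeasureTheory.integral_const_mul, integral_exp_neg_Ioi]
    _ ≤ ∫ y in Set.Ioi M, exp (-y) * y ^ (x + 1 - 1) := by
        refine setIntegral_mono_on ((integrableOn_exp_neg_Ioi M).const_mul _)
          (hI.mono_set hsub) measurableSet_Ioi fun y hy ↦ ?_
        rw [add_sub_cancel_right, mul_comm]
        have : M ≤ y := le_of_lt hy
        gcongr
    _ ≤ _ := by
        refine setIntegral_mono_set hI ?_ hsub.eventuallyLE
        filter_upwards [ae_restrict_mem measurableSet_Ioi] with y hy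
        have : (0 : ℝ) < y := hy
        simp only [Pi.zero_apply]
        positivity

theorem summable_mittagLeffler {α : ℝ} (hα : 0 < α) (x : ℝ) :
    Summable fun j : ℕ ↦ x ^ j / Gamma (α * j + 1) := by
  set K : ℝ := 2 * |x| + 1 with hK
  have hKpos : 0 < K := by positivity
  have hMpos : 0 < K ^ α⁻¹ := rpow_pos_of_pos hKpos _
  have hlt : |x| / K < 1 := by
    rw [div_lt_one hKpos]; linarith [abs_nonneg x]
  refine .of_norm_bounded ((summable_geometric_of_lt_one (by positivity) hlt).mul_left
    (exp (K ^ α⁻¹))) fun j ↦ ?_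
  have h := rpow_mul_exp_neg_le_Gamma_add_one hMpos (x := α * j) (by positivity)
  rw [← rpow_mul hKpos.le, inv_mul_cancel_left₀ hα.ne', rpow_natCast, exp_neg] at h
  have hG : 0 < Gamma (α * j + 1) := Gamma_pos_of_pos (by positivity)
  rw [norm_div, norm_pow, norm_eq_abs, norm_of_nonneg hG.le, div_pow]
  calc |x| ^ j / Gamma (α * j + 1) ≤ |x| ^ j / (K ^ j * (exp (K ^ α⁻¹))⁻¹) := by gcongr
    _ = _ := by field_simp

theorem intervalIntegrable_sub_rpow_mul_rpow {α p : ℝ} (hα : α < 1) (hp : 0 ≤ p) (τ : ℝ) :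
    IntervalIntegrable (fun s : ℝ ↦ (τ - s) ^ (-α) * s ^ p) volume 0 τ := by
  have h := ((intervalIntegrable_rpow' (a := 0) (b := τ) (r := -α) (by linarith)).comp_sub_left
    τ).symm
  simp only [sub_zero, sub_self] at h
  exact h.mul_continuousOn (continuous_rpow_const hp).continuousOn

theorem integral_sub_rpow_mul_rpow {α p τ : ℝ} (hα : α < 1) (hp : 0 ≤ p) (hτ : 0 < τ) :
    ∫ s in (0 : ℝ)..τ, (τ - s) ^ (-α) * s ^ p =
      τ ^ (p + 1 - α) * (Gamma (p + 1) * Gamma (1 - α) / Gamma (p + 2 - α)) := by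
  have h := Complex.betaIntegral_scaled (p + 1 : ℝ) (1 - α : ℝ) hτ
  rw [Complex.betaIntegral_eq_Gamma_mul_div _ _ (by simp; linarith) (by simp; linarith),
    ← Complex.ofReal_add] at h
  simp only [Complex.Gamma_ofReal] at h
  apply Complex.ofReal_injective
  rw [← intervalIntegral.integral_ofReal]
  push_cast
  rw [Complex.ofReal_cpow hτ.le]
  convert! h using 1
  · refine intervalIntegral.integral_congr fun s hs ↦ ?_
    rw [Set.uIcc_of_le hτ.le] at hs
    rw [Complex.ofReal_cpow (sub_nonneg.2 hs.2), Complex.ofReal_cpow hs.1, mul_comm]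
    push_cast
    ring_nf
  · push_cast
    ring_nf

theorem summable_pow_mul_rpow_div_Gamma_add_two {α : ℝ} (hα : 0 < α) (c C : ℝ) {τ : ℝ}
    (hτ : 0 < τ) :
    Summable fun j : ℕ ↦ c ^ (j + 1) * C * (τ ^ (α * j + 1) / Gamma (α * j + 2)) := by
  refine .of_norm_bounded
    ((summable_mittagLeffler hα (|c| * τ ^ α)).mul_left (|c| * |C| * τ)) fun j ↦ ?_
  have hj : 0 ≤ α * j := by positivity
  have hG : 0 < Gamma (α * j + 1) := Gamma_pos_of_pos (by positivity)
  have hle : Gamma (α * j + 1) ≤ Gamma (α * j + 2) := by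
    rw [show α * j + 2 = α * j + 1 + 1 by ring, Gamma_add_one (s := α * j + 1) (by positivity)]
    nlinarith
  rw [norm_mul, norm_mul, norm_pow, norm_div, norm_of_nonneg (rpow_nonneg hτ.le _),
    norm_of_nonneg (hG.le.trans hle), norm_eq_abs, norm_eq_abs]
  calc |c| ^ (j + 1) * |C| * (τ ^ (α * j + 1) / Gamma (α * j + 2))
      ≤ |c| ^ (j + 1) * |C| * (τ ^ (α * j + 1) / Gamma (α * j + 1)) := by gcongr
    _ = _ := by
      rw [mul_pow, ← rpow_mul_natCast hτ.le, rpow_add hτ, rpow_one]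
      ring

theorem integral_sub_rpow_mul_mittagLeffler_sub_one {α : ℝ} (hα : α ∈ Set.Ioo (0 : ℝ) 1) (l : ℝ)
    {τ : ℝ} (hτ : 0 < τ) :
    ∫ s in (0 : ℝ)..τ, (τ - s) ^ (-α) * (mittagLeffler α (-l * s ^ α) - 1) =
      ∑' j : ℕ, (-l) ^ (j + 1) * Gamma (1 - α) * (τ ^ (α * j + 1) / Gamma (α * j + 2)) := by
  obtain ⟨h0, h1⟩ := hα
  let c : ℕ → ℝ := fun j ↦ (-l) ^ (j + 1) / Gamma (α * (j + 1 : ℕ) + 1)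
  let F : ℕ → ℝ → ℝ := fun j s ↦ c j * ((τ - s) ^ (-α) * s ^ (α * (j + 1 : ℕ)))
  have hp (j : ℕ) : 0 ≤ α * (j + 1 : ℕ) := by positivity
  have hG (j : ℕ) : 0 < Gamma (α * j + 1) := Gamma_pos_of_pos (by positivity)
  have hint (j : ℕ) : ∫ s in Set.Ioc 0 τ, (τ - s) ^ (-α) * s ^ (α * (j + 1 : ℕ)) =
      Gamma (α * (j + 1 : ℕ) + 1) * (Gamma (1 - α) * (τ ^ (α * j + 1) / Gamma (α * j + 2))) := by
    rw [← intervalIntegral.integral_of_le hτ.le, integral_sub_rpow_mul_rpow h1 (hp j) hτ]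
    push_cast
    ring_nf
  have hF (j : ℕ) : Integrable (F j) (volume.restrict (Set.Ioc 0 τ)) :=
    ((intervalIntegrable_iff_integrableOn_Ioc_of_le hτ.le).1
      (intervalIntegrable_sub_rpow_mul_rpow h1 (hp j) τ)).const_mul _
  have hnorm (j : ℕ) : ∫ s in Set.Ioc 0 τ, ‖F j s‖ =
      |l| ^ (j + 1) * Gamma (1 - α) * (τ ^ (α * j + 1) / Gamma (α * j + 2)) := by
    have : ∫ s in Set.Ioc 0 τ, ‖F j s‖ =
        ∫ s in Set.Ioc 0 τ, |c j| * ((τ - s) ^ (-α) * s ^ (α * (j + 1 : ℕ))) := by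
      refine setIntegral_congr_fun measurableSet_Ioc fun s hs ↦ ?_
      have hs1 := sub_nonneg.2 hs.2
      have hs0 := hs.1.le
      simp only [F, norm_mul, norm_eq_abs]
      rw [abs_of_nonneg (rpow_nonneg hs1 _), abs_of_nonneg (rpow_nonneg hs0 _)]
    rw [this, MeasureTheory.integral_const_mul, hint]
    simp only [c, abs_div, abs_pow, abs_neg, abs_of_pos (hG (j + 1))]
    have := (hG (j + 1)).ne'
    field_simp
  have hsum : Summable fun j : ℕ ↦
      |l| ^ (j + 1) * Gamma (1 - α) * (τ ^ (α * j + 1) / Gamma (α * j + 2)) :=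
    summable_pow_mul_rpow_div_Gamma_add_two h0 _ _ hτ
  have hS := hasSum_integral_of_summable_integral_norm hF (by simpa only [hnorm] using hsum)
  rw [intervalIntegral.integral_of_le hτ.le]
  trans ∫ s in Set.Ioc 0 τ, ∑' j, F j s
  · refine setIntegral_congr_fun measurableSet_Ioc fun s hs ↦ ?_
    simp only [mittagLeffler, F, c]
    rw [(summable_mittagLeffler h0 _).tsum_eq_zero_add]
    simp only [pow_zero, Nat.cast_zero, mul_zero, zero_add, Gamma_one, div_one, add_sub_cancel_left]
    rw [← tsum_mul_left]
    refine tsum_congr fun j ↦ ?_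
    rw [mul_pow, ← rpow_mul_natCast hs.1.le]
    ring
  · rw [← hS.tsum_eq]
    refine tsum_congr fun j ↦ ?_
    simp only [F, c]
    rw [MeasureTheory.integral_const_mul, hint]
    have := (hG (j + 1)).ne'
    field_simp

/-- `u(t) = E_α(−λ t^α)` is an eigenfunction of the regularized Caputo
derivative of order `α ∈ (0,1)` with eigenvalue `−λ`: for every `t > 0`, the convolution
`τ ↦ ∫_0^τ (τ−s)^{-α} (u(s) − 1) ds` is differentiable at `t` and
`(1/Γ(1−α)) (d/dt) ∫_0^t (t−s)^{-α} (u(s) − u(0)) ds = −λ E_α(−λ t^α)` (with `u(0) = 1`). -/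
theorem mittagLeffler_eigenfunction_caputo
    (α : ℝ) (hα : α ∈ Set.Ioo (0 : ℝ) 1) (l : ℝ) (hl : 0 < l)
    (t : ℝ) (ht : 0 < t) :
    ∃ D : ℝ,
      HasDerivAt (fun τ : ℝ =>
          ∫ s in (0 : ℝ)..τ, (τ - s) ^ (-α) * (mittagLeffler α (-l * s ^ α) - 1)) D t ∧
      (1 / Real.Gamma (1 - α)) * D = -l * mittagLeffler α (-l * t ^ α) := by
  obtain ⟨h0, h1⟩ := hα
  have hΓ : Gamma (1 - α) ≠ 0 := (Gamma_pos_of_pos (by linarith)).ne'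
  have hser {y : ℝ} (hy : 0 ≤ y) (c : ℝ) (j : ℕ) :
      c ^ (j + 1) * Gamma (1 - α) * (y ^ (α * j) / Gamma (α * j + 1)) =
        c * Gamma (1 - α) * ((c * y ^ α) ^ j / Gamma (α * j + 1)) := by
    rw [mul_pow, ← rpow_mul_natCast hy]
    ring
  refine ⟨∑' j : ℕ, (-l) ^ (j + 1) * Gamma (1 - α) * (t ^ (α * j) / Gamma (α * j + 1)), ?_, ?_⟩
  · have hT : 0 ≤ t + 1 := by linarith
    have htmem : t ∈ Set.Ioo 0 (t + 1) := ⟨ht, lt_add_one t⟩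
    have hu : Summable fun j : ℕ ↦
        l ^ (j + 1) * Gamma (1 - α) * ((t + 1) ^ (α * j) / Gamma (α * j + 1)) := by
      simp_rw [hser hT]
      exact (summable_mittagLeffler h0 _).mul_left _
    have hev := Filter.eventually_of_mem (Ioi_mem_nhds ht) fun τ hτ ↦
      integral_sub_rpow_mul_mittagLeffler_sub_one ⟨h0, h1⟩ l hτ
    refine HasDerivAt.congr_of_eventuallyEq ?_ hev
    refine hasDerivAt_tsum_of_isPreconnected
      (g := fun (j : ℕ) τ ↦ (-l) ^ (j + 1) * Gamma (1 - α) * (τ ^ (α * j + 1) / Gamma (α * j + 2)))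
      (g' := fun (j : ℕ) τ ↦ (-l) ^ (j + 1) * Gamma (1 - α) * (τ ^ (α * j) / Gamma (α * j + 1)))
      hu isOpen_Ioo isPreconnected_Ioo (fun j y hy ↦ ?_) (fun j y hy ↦ ?_) htmem
      (summable_pow_mul_rpow_div_Gamma_add_two h0 _ _ ht) htmem
    · have hG : 0 < Gamma (α * j + 1) := Gamma_pos_of_pos (by positivity)
      have hj : 0 < α * j + 1 := by positivity
      have h := ((hasDerivAt_rpow_const (p := α * j + 1) (Or.inl hy.1.ne')).div_const
        (Gamma (α * j + 2))).const_mul ((-l) ^ (j + 1) * Gamma (1 - α))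
      convert! h using 1
      rw [show α * j + 2 = α * j + 1 + 1 by ring, Gamma_add_one hj.ne', add_sub_cancel_right,
        mul_div_mul_left _ _ hj.ne']
    · have hG : 0 < Gamma (α * j + 1) := Gamma_pos_of_pos (by positivity)
      have hΓ' : 0 < Gamma (1 - α) := Gamma_pos_of_pos (by linarith)
      have hy0 := hy.1.le
      have hyT := hy.2.le
      rw [norm_mul, norm_mul, norm_pow, norm_neg, norm_div, norm_of_nonneg (rpow_nonneg hy0 _),
        norm_of_nonneg hG.le, norm_of_nonneg hΓ'.le, norm_of_nonneg hl.le]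
      gcongr
  · simp_rw [hser ht.le]
    rw [tsum_mul_left, mittagLeffler]
    field_simp
end

section
/- Let n ≥ 1, let m be a probability density on (0, ∞), and let f : closure(D)ⁿ → ℂ be continuous on closure(D)ⁿ, analytic in each variable on D, with absolutely convergent multivariate expansion f(z₁, …, zₙ) = ∑_{k₁,…,kₙ ≥ 0} a_{k₁…kₙ} z₁^{k₁} ⋯ zₙ^{kₙ}. Then for all z₁, …, zₙ ∈ closure(D), ∫_0^∞ [∫_{ℝⁿ} f(z₁ e^{-iu₁}, …, zₙ e^{-iuₙ}) (2πy)^{-n/2} e^{-(u₁²+⋯+uₙ²)/(2y)} du₁ ⋯ duₙ] m(y) dy = ∑_{k₁,…,kₙ ≥ 0} a_{k₁…kₙ} z₁^{k₁} ⋯ zₙ^{kₙ} ∫_0^∞ e^{-(k₁²+⋯+kₙ²) y/2} m(y) dy, the series converging absolutely. -/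
open MeasureTheory Real Complex

open ProbabilityTheory

/-- Termwise integration of an absolutely summable series of bounded functions against an
integrable nonnegative weight. -/
theorem hasSum_integral_mul_weight {α ι : Type*} [MeasurableSpace α] [Countable ι]
    {μ : Measure α} {c : ι → ℂ} (hc : Summable fun k => ‖c k‖) {φ : ι → α → ℂ} {w : α → ℝ}
    (hw_nonneg : ∀ x, 0 ≤ w x) (hw : Integrable w μ)
    (hφ_meas : ∀ k, AEStronglyMeasurable (φ k) μ) (hφ : ∀ k, ∀ᵐ x ∂μ, ‖φ k x‖ ≤ 1)
    {F : α → ℂ} (hF : ∀ᵐ x ∂μ, HasSum (fun k => c k * φ k x) (F x)) :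
    HasSum (fun k => c k * ∫ x, φ k x * (w x : ℂ) ∂μ) (∫ x, F x * (w x : ℂ) ∂μ) := by
  simp_rw [← integral_const_mul]
  refine hasSum_integral_of_dominated_convergence (fun k x => ‖c k‖ * w x)
    (fun k => ?_) (fun k => ?_) (ae_of_all _ fun x => hc.mul_right _) ?_ ?_
  · exact ((hφ_meas k).mul
      (Complex.continuous_ofReal.comp_aestronglyMeasurable hw.aestronglyMeasurable)).const_mul _
  · filter_upwards [hφ k] with x hx
    rw [norm_mul, norm_mul, Complex.norm_real, Real.norm_of_nonneg (hw_nonneg x)]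
    gcongr
    exact mul_le_of_le_one_left (hw_nonneg x) hx
  · simp_rw [tsum_mul_right]
    exact hw.const_mul _
  · filter_upwards [hF] with x hx
    simpa only [mul_assoc] using hx.mul_right (w x : ℂ)

theorem gaussian_kernel_eq_prod_gaussianPDFReal (n : ℕ) {y : ℝ} (hy : 0 < y) (u : Fin n → ℝ) :
    (2 * Real.pi * y) ^ (-(n : ℝ) / 2) * Real.exp (-(∑ i, (u i) ^ 2) / (2 * y)) =
      ∏ i, gaussianPDFReal 0 y.toNNReal (u i) := by
  have h2 : 0 ≤ 2 * Real.pi * y := by positivity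
  simp only [gaussianPDFReal, Real.coe_toNNReal y hy.le, sub_zero]
  rw [Finset.prod_mul_distrib, ← Real.exp_sum, Finset.prod_const, Finset.card_univ,
    Fintype.card_fin, ← Finset.sum_div, Finset.sum_neg_distrib]
  congr 1
  rw [Real.sqrt_eq_rpow, ← Real.rpow_neg h2, ← Real.rpow_natCast, ← Real.rpow_mul h2]
  congr 1
  ring

theorem integral_cexp_mul_gaussianPDFReal {v : NNReal} (hv : v ≠ 0) (t : ℝ) :
    ∫ x : ℝ, Complex.exp (-Complex.I * (x : ℂ) * t) * (gaussianPDFReal 0 v x : ℂ) =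
      Complex.exp (-(v * t ^ 2 / 2)) := by
  have h := charFun_gaussianReal (μ := 0) (v := v) (-t)
  rw [charFun_apply_real, integral_gaussianReal_eq_integral_smul hv] at h
  convert h using 1
  · refine integral_congr_ae (ae_of_all _ fun x => ?_)
    simp only [Complex.real_smul, Complex.ofReal_neg]
    rw [mul_comm]
    congr 2
    ring
  · congr 1
    push_cast
    ring

theorem integral_prod_cexp_mul_gaussianPDFReal {n : ℕ} {v : NNReal} (hv : v ≠ 0)
    (k : Fin n → ℕ) :
    ∫ u : Fin n → ℝ, (∏ i, Complex.exp (-Complex.I * (u i : ℂ)) ^ k i) *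
        ((∏ i, gaussianPDFReal 0 v (u i) : ℝ) : ℂ) =
      ((Real.exp (-(∑ i, (k i : ℝ) ^ 2) * v / 2) : ℝ) : ℂ) := by
  have h (u : Fin n → ℝ) : (∏ i, Complex.exp (-Complex.I * (u i : ℂ)) ^ k i) *
      ((∏ i, gaussianPDFReal 0 v (u i) : ℝ) : ℂ) =
      ∏ i, Complex.exp (-Complex.I * (u i : ℂ) * (k i : ℝ)) * (gaussianPDFReal 0 v (u i) : ℂ) := by
    rw [Complex.ofReal_prod, ← Finset.prod_mul_distrib]
    refine Finset.prod_congr rfl fun i _ => ?_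
    rw [← Complex.exp_nat_mul, mul_comm (k i : ℂ), Complex.ofReal_natCast]
  simp_rw [h]
  rw [integral_fintype_prod_volume_eq_prod (fun i (x : ℝ) =>
    Complex.exp (-Complex.I * (x : ℂ) * (k i : ℝ)) * (gaussianPDFReal 0 v x : ℂ))]
  simp_rw [integral_cexp_mul_gaussianPDFReal hv]
  rw [← Complex.exp_sum, Complex.ofReal_exp]
  congr 1
  push_cast
  rw [Finset.sum_neg_distrib, ← Finset.sum_div, ← Finset.mul_sum]
  ring

/-- The Gauss–Weierstrass integral of an absolutely convergent power series, term by term. -/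
theorem hasSum_integral_gaussian_kernel {n : ℕ} {f : (Fin n → ℂ) → ℂ} {a : (Fin n → ℕ) → ℂ}
    (hf : ∀ z : Fin n → ℂ, (∀ i, ‖z i‖ ≤ 1) → HasSum (fun k => a k * ∏ i, z i ^ k i) (f z))
    {z : Fin n → ℂ} (hz : ∀ i, ‖z i‖ ≤ 1) (hsum : Summable fun k => ‖a k * ∏ i, z i ^ k i‖)
    {y : ℝ} (hy : 0 < y) :
    HasSum (fun k : Fin n → ℕ => a k * (∏ i, z i ^ k i) *
        ((Real.exp (-(∑ i, (k i : ℝ) ^ 2) * y / 2) : ℝ) : ℂ))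
      (∫ u : Fin n → ℝ, f (fun i => z i * Complex.exp (-Complex.I * (u i : ℂ))) *
        (((2 * Real.pi * y) ^ (-(n : ℝ) / 2) *
          Real.exp (-(∑ i, (u i) ^ 2) / (2 * y)) : ℝ) : ℂ)) := by
  have hv : y.toNNReal ≠ 0 := (Real.toNNReal_pos.2 hy).ne'
  have hexp (x : ℝ) : ‖Complex.exp (-Complex.I * (x : ℂ))‖ = 1 := by
    rw [Complex.norm_exp]; simp
  simp_rw [gaussian_kernel_eq_prod_gaussianPDFReal n hy]
  have h := hasSum_integral_mul_weight (μ := (volume : Measure (Fin n → ℝ))) hsum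
    (φ := fun k u => ∏ i, Complex.exp (-Complex.I * (u i : ℂ)) ^ k i)
    (w := fun u => ∏ i, gaussianPDFReal 0 y.toNNReal (u i))
    (F := fun u => f (fun i => z i * Complex.exp (-Complex.I * (u i : ℂ))))
    (fun u => Finset.prod_nonneg fun i _ => gaussianPDFReal_nonneg _ _ _)
    (Integrable.fintype_prod fun _ => integrable_gaussianPDFReal 0 y.toNNReal)
    (fun k => Continuous.aestronglyMeasurable (by fun_prop))
    (fun k => ae_of_all _ fun u => by simp only [norm_prod, norm_pow, hexp]; simp)
    (ae_of_all _ fun u => by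
      convert hf (fun i => z i * Complex.exp (-Complex.I * (u i : ℂ)))
        (fun i => by rw [norm_mul, hexp, mul_one]; exact hz i) using 2 with k
      simp_rw [mul_pow, Finset.prod_mul_distrib]
      ring)
  simpa only [integral_prod_cexp_mul_gaussianPDFReal hv, Real.coe_toNNReal y hy.le] using h

/-- multidimensional version: for a probability density `m` on `(0,∞)` and
`f ∈ A(Dⁿ)` with absolutely convergent multivariate expansion
`f(z) = ∑_{k₁,…,kₙ} a_{k₁…kₙ} z₁^{k₁}⋯zₙ^{kₙ}`, the mixture of `n`-dimensional
Gauss–Weierstrass integrals equals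
`∑_k a_k z₁^{k₁}⋯zₙ^{kₙ} ∫_0^∞ e^{-(k₁²+⋯+kₙ²)y/2} m(y) dy`, converging absolutely. -/
theorem multidim_gaussian_mixture_series_representation
    (n : ℕ) (hn : 1 ≤ n)
    (m : ℝ → ℝ) (hm_meas : Measurable m) (hm_nonneg : ∀ y, 0 ≤ m y)
    (hm_prob : ∫ y in Set.Ioi (0 : ℝ), m y = 1)
    (f : (Fin n → ℂ) → ℂ) (a : (Fin n → ℕ) → ℂ)
    (hf_cont : ContinuousOn f {z : Fin n → ℂ | ∀ i, ‖z i‖ ≤ 1})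
    (hf_an : ∀ (i : Fin n) (z : Fin n → ℂ), (∀ j, ‖z j‖ ≤ 1) →
      AnalyticOn ℂ (fun w : ℂ => f (Function.update z i w)) (Metric.ball (0 : ℂ) 1))
    (hf_taylor : ∀ z : Fin n → ℂ, (∀ i, ‖z i‖ ≤ 1) →
      Summable (fun k : Fin n → ℕ => ‖a k * ∏ i, z i ^ k i‖) ∧
      HasSum (fun k : Fin n → ℕ => a k * ∏ i, z i ^ k i) (f z))
    (z : Fin n → ℂ) (hz : ∀ i, ‖z i‖ ≤ 1) :
    Summable (fun k : Fin n → ℕ => ‖a k * (∏ i, z i ^ k i) *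
      ((∫ y in Set.Ioi (0 : ℝ),
        Real.exp (-(∑ i, ((k i : ℝ)) ^ 2) * y / 2) * m y : ℝ) : ℂ)‖) ∧
    HasSum (fun k : Fin n → ℕ => a k * (∏ i, z i ^ k i) *
        ((∫ y in Set.Ioi (0 : ℝ),
          Real.exp (-(∑ i, ((k i : ℝ)) ^ 2) * y / 2) * m y : ℝ) : ℂ))
      (∫ y in Set.Ioi (0 : ℝ),
        (∫ u : Fin n → ℝ, f (fun i => z i * Complex.exp (-Complex.I * (u i : ℂ))) *
          (((2 * Real.pi * y) ^ (-(n : ℝ) / 2) *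
            Real.exp (-(∑ i, (u i) ^ 2) / (2 * y)) : ℝ) : ℂ)) * ((m y : ℝ) : ℂ)) := by
  obtain ⟨hsum, -⟩ := hf_taylor z hz
  have hm_int : Integrable m (volume.restrict (Set.Ioi 0)) :=
    Integrable.of_integral_ne_zero (by rw [hm_prob]; exact one_ne_zero)
  have hle (k : Fin n → ℕ) {y : ℝ} (hy : 0 < y) :
      Real.exp (-(∑ i, (k i : ℝ) ^ 2) * y / 2) ≤ 1 := by
    have : 0 ≤ (∑ i, (k i : ℝ) ^ 2) * y := by positivity
    exact Real.exp_le_one_iff.2 (by linarith)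
  have h := hasSum_integral_mul_weight (μ := volume.restrict (Set.Ioi (0 : ℝ))) hsum
    (φ := fun k y => ((Real.exp (-(∑ i, (k i : ℝ) ^ 2) * y / 2) : ℝ) : ℂ))
    (w := m) hm_nonneg hm_int
    (fun k => Continuous.aestronglyMeasurable (by fun_prop))
    (fun k => by
      filter_upwards [ae_restrict_mem measurableSet_Ioi] with y hy
      rw [Complex.norm_real, Real.norm_of_nonneg (Real.exp_pos _).le]
      exact hle k hy)
    (by
      filter_upwards [ae_restrict_mem measurableSet_Ioi] with y hy
      exact hasSum_integral_gaussian_kernel (fun z hz => (hf_taylor z hz).2) hz hsum hy)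
  simp_rw [← Complex.ofReal_mul, integral_complex_ofReal] at h
  exact ⟨h.summable.norm, h⟩
end
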